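/- For every positive integer c there exists a constant ε = ε(c) > 0 such that every continuous ε-light map f : [0,1]^c → ℝ^c has a stable value. -/

import Mathlib

/-- A point `y` is a *stable value* of the continuous map `f : X → Y` if there is `ε > 0`
such that `y` is in the range of every continuous map `g` that is pointwise `ε`-close to `f`. -/
def IsStableValue {X Y : Type*} [MetricSpace X] [MetricSpace Y] (f : X → Y) (y : Y) : Prop :=
  ∃ ε > (0 : ℝ), ∀ g : X → Y, Continuous g → (∀ x, dist (f x) (g x) < ε) → y ∈ Set.range g

/-- A map `f : X → Y` is *`ε`-light* if for every `y ∈ Y` every connected component of the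
fiber `f⁻¹ {y}` has diameter strictly less than `ε`. -/
def IsLightMap {X Y : Type*} [MetricSpace X] [MetricSpace Y] (f : X → Y) (ε : ℝ) : Prop :=
  ∀ (y : Y), ∀ x ∈ f ⁻¹' {y},
    EMetric.diam (connectedComponentIn (f ⁻¹' {y}) x) < ENNReal.ofReal ε

open MeasureTheory Metric Set

theorem exists_polynomial_eval_eq_det {E : Type*} [NormedAddCommGroup E] [NormedSpace ℝ E]
    [FiniteDimensional ℝ E] (A : E →L[ℝ] E) :
    ∃ p : Polynomial ℝ, p.natDegree ≤ Module.finrank ℝ E ∧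
      ∀ t : ℝ, p.eval t = (ContinuousLinearMap.id ℝ E + t • A).det := by
  classical
  let b := Module.finBasis ℝ E
  let M := LinearMap.toMatrix b b (A : E →ₗ[ℝ] E)
  refine ⟨((Polynomial.X : Polynomial ℝ) • M.map Polynomial.C +
    (1 : Matrix (Fin (Module.finrank ℝ E)) (Fin (Module.finrank ℝ E)) ℝ).map Polynomial.C).det,
    ?_, fun t => ?_⟩
  · simpa using Polynomial.natDegree_det_X_add_C_le M 1
  · have h : (ContinuousLinearMap.id ℝ E + t • A).det = (1 + t • M).det := by
      rw [ContinuousLinearMap.det, ← LinearMap.det_toMatrix b]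
      congr 1
      simp [M]
    rw [h, ← Polynomial.coe_evalRingHom, RingHom.map_det]
    congr 1
    ext i j
    simp [Matrix.one_apply, apply_ite, add_comm, mul_comm t]

/-- Values at `1` of polynomials of degree at most `n` are a fixed affine combination of the
values at points of `[0, a]`. -/
theorem exists_extrapolation (n : ℕ) {a : ℝ} (ha : 0 < a) :
    ∃ (τ w : ℕ → ℝ), (∀ i ∈ Finset.range (n + 1), τ i ∈ Icc 0 a) ∧
      ∑ i ∈ Finset.range (n + 1), w i = 1 ∧
      ∀ p : Polynomial ℝ, p.natDegree ≤ n →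
        p.eval 1 = ∑ i ∈ Finset.range (n + 1), w i * p.eval (τ i) := by
  let τ : ℕ → ℝ := fun i => a * (i / (n + 1))
  have hτ : InjOn τ (Finset.range (n + 1) : Set ℕ) := by
    intro i _ j _ h
    have h1 : (n + 1 : ℝ) ≠ 0 := by positivity
    simp only [τ] at h
    field_simp at h
    exact_mod_cast h
  refine ⟨τ, fun i => (Lagrange.basis (Finset.range (n + 1)) τ i).eval 1, ?_, ?_, ?_⟩
  · intro i hi
    have : (i : ℝ) / (n + 1) ≤ 1 := by
      rw [div_le_one (by positivity)]
      have := Finset.mem_range.1 hi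
      exact_mod_cast this.le
    exact ⟨by positivity, mul_le_of_le_one_right ha.le this⟩
  · rw [← Polynomial.eval_finsetSum, Lagrange.sum_basis hτ ⟨0, by simp⟩, Polynomial.eval_one]
  · intro p hp
    have hd : p.degree < (Finset.range (n + 1)).card := by
      rw [Finset.card_range]
      exact lt_of_le_of_lt p.degree_le_natDegree (by exact_mod_cast Nat.lt_succ_of_le hp)
    conv_lhs => rw [Lagrange.eq_interpolate hτ hd]
    simp [Lagrange.interpolate_apply, Polynomial.eval_finsetSum, mul_comm]

section Retraction

variable {E : Type*} [NormedAddCommGroup E] [InnerProductSpace ℝ E] [FiniteDimensional ℝ E]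

theorem det_fderiv_eq_zero_of_norm_eq {r : E → E} {R : ℝ} (hR : 0 < R) (hr : Differentiable ℝ r)
    (hn : ∀ x, ‖r x‖ = R) (x : E) : (fderiv ℝ r x).det = 0 := by
  by_contra hdet
  let e := ContinuousLinearMap.toContinuousLinearEquivOfDetNeZero (fderiv ℝ r x) hdet
  have h1 : HasFDerivAt (fun y => inner ℝ (r y) (r y)) (0 : E →L[ℝ] ℝ) x := by
    have : (fun y => inner ℝ (r y) (r y)) = fun _ => R ^ 2 := by
      ext y; rw [real_inner_self_eq_norm_sq, hn]
    rw [this]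
    exact hasFDerivAt_const _ _
  have h2 := ((hr x).hasFDerivAt.inner ℝ (hr x).hasFDerivAt).unique h1
  have h3 := congrArg (fun L : E →L[ℝ] ℝ => L (e.symm (r x))) h2
  have h4 : fderiv ℝ r x (e.symm (r x)) = r x := e.apply_symm_apply (r x)
  simp [h4, hn] at h3
  exact hR.ne' h3

/-- There is no `C¹` retraction of a ball onto its boundary sphere. -/
theorem not_exists_contDiff_retraction [MeasurableSpace E] [BorelSpace E] {r : E → E} {R : ℝ}
    (hR : 0 < R) (hr : ContDiff ℝ 1 r)
    (hn : ∀ x, ‖r x‖ = R) (hfix : ∀ x, ‖x‖ = R → r x = x) : False := by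
  have hd : Differentiable ℝ r := hr.differentiable (by simp)
  set A : E → E →L[ℝ] E := fun x => fderiv ℝ r x - ContinuousLinearMap.id ℝ E with hA
  have hAc : Continuous A := (hr.continuous_fderiv (by simp)).sub continuous_const
  obtain ⟨C, hC⟩ := (isCompact_closedBall (0 : E) R).exists_bound_of_continuousOn hAc.continuousOn
  have hC0 : 0 ≤ C := (norm_nonneg _).trans (hC 0 (by simp [hR.le]))
  set s : ℝ → E → E := fun t x => x + t • (r x - x) with hs
  have hsd : ∀ t x, HasStrictFDerivAt (s t) (ContinuousLinearMap.id ℝ E + t • A x) x := by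
    intro t x
    exact (hasStrictFDerivAt_id x).add
      (((hr.contDiffAt.hasStrictFDerivAt (by simp)).sub (hasStrictFDerivAt_id x)).const_smul t)
  obtain ⟨a, ha0, ha1, haC⟩ : ∃ a : ℝ, 0 < a ∧ a < 1 ∧ a * C < 1 := by
    refine ⟨1 / (C + 2), by positivity, ?_, ?_⟩
    · rw [div_lt_one (by positivity)]; linarith
    · rw [one_div, inv_mul_lt_iff₀ (by positivity)]; linarith
  have htC : ∀ t ∈ Icc 0 a, t * C < 1 := fun t ht =>
    (mul_le_mul_of_nonneg_right ht.2 hC0).trans_lt haC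
  -- the derivative of `s t` is injective with positive determinant
  have hdet0 : ∀ x ∈ closedBall (0 : E) R, ∀ t ∈ Icc 0 a,
      (ContinuousLinearMap.id ℝ E + t • A x).det ≠ 0 := by
    intro x hx t ht h0
    obtain ⟨v, hv, hv0⟩ := (Submodule.ne_bot_iff _).1 (LinearMap.bot_lt_ker_of_det_eq_zero h0).ne'
    have h1 : v + t • A x v = 0 := by simpa using hv
    have h2 : ‖v‖ ≤ t * C * ‖v‖ := by
      calc ‖v‖ = ‖t • A x v‖ := by
            rw [← norm_neg (t • A x v)]
            exact congrArg norm (eq_neg_of_add_eq_zero_left h1)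
        _ = t * ‖A x v‖ := by rw [norm_smul, Real.norm_of_nonneg ht.1]
        _ ≤ t * (C * ‖v‖) := by gcongr; exacts [ht.1, (A x).le_of_opNorm_le (hC x hx) v]
        _ = _ := by ring
    have := norm_pos_iff.2 hv0
    nlinarith [htC t ht]
  have hdet : ∀ x ∈ closedBall (0 : E) R, ∀ t ∈ Icc 0 a,
      0 < (ContinuousLinearMap.id ℝ E + t • A x).det := by
    intro x hx t ht
    by_contra hneg
    have hcont : Continuous fun u : ℝ => (ContinuousLinearMap.id ℝ E + u • A x).det :=
      ContinuousLinearMap.continuous_det.comp (by fun_prop)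
    have h0 : (ContinuousLinearMap.id ℝ E + (0 : ℝ) • A x).det = 1 := by simp [ContinuousLinearMap.det]
    obtain ⟨u, hu, hu0⟩ := intermediate_value_Icc' ht.1 hcont.continuousOn
      (show (0 : ℝ) ∈ _ from ⟨not_lt.1 hneg, by rw [h0]; exact zero_le_one⟩)
    exact hdet0 x hx u ⟨hu.1, hu.2.trans ht.2⟩ hu0
  have hinj : ∀ t ∈ Icc 0 a, InjOn (s t) (closedBall 0 R) := by
    intro t ht x hx y hy hxy
    have h1 : ‖(r y - y) - (r x - x)‖ ≤ C * ‖y - x‖ :=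
      (convex_closedBall (0 : E) R).norm_image_sub_le_of_norm_hasFDerivWithin_le
        (f := fun z => r z - z)
        (fun z _ => ((hd z).hasFDerivAt.sub (hasFDerivAt_id z)).hasFDerivWithinAt) hC hx hy
    have h2 : y - x = -(t • ((r y - y) - (r x - x))) := by
      simp only [hs] at hxy
      rw [smul_sub, neg_sub, sub_eq_sub_iff_add_eq_add, ← hxy, add_comm]
    have h3 : ‖y - x‖ ≤ t * C * ‖y - x‖ := by
      calc ‖y - x‖ = t * ‖(r y - y) - (r x - x)‖ := by
            conv_lhs => rw [h2]
            rw [norm_neg, norm_smul, Real.norm_of_nonneg ht.1]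
        _ ≤ t * (C * ‖y - x‖) := by gcongr; exact ht.1
        _ = _ := by ring
    have h4 : ‖y - x‖ = 0 := by
      nlinarith [htC t ht, norm_nonneg (y - x)]
    exact (sub_eq_zero.1 (norm_eq_zero.1 h4)).symm
  have himage : ∀ t ∈ Icc 0 a, s t '' ball 0 R = ball 0 R := by
    intro t ht
    have hsub : s t '' ball 0 R ⊆ ball 0 R := by
      rintro _ ⟨x, hx, rfl⟩
      rw [mem_ball_zero_iff] at hx ⊢
      have : s t x = (1 - t) • x + t • r x := by simp only [hs]; module
      rw [this]
      have ht1 : 0 < 1 - t := by linarith [ht.2]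
      calc ‖(1 - t) • x + t • r x‖ ≤ (1 - t) * ‖x‖ + t * R := by
            refine (norm_add_le _ _).trans_eq ?_
            rw [norm_smul, norm_smul, hn, Real.norm_of_nonneg ht.1, Real.norm_of_nonneg ht1.le]
        _ < (1 - t) * R + t * R := by gcongr
        _ = R := by ring
    have hsc : Continuous (s t) := continuous_iff_continuousAt.2 fun x => (hsd t x).continuousAt
    have hopen : IsOpen (s t '' ball 0 R) := by
      rw [isOpen_iff_mem_nhds]
      rintro _ ⟨x, hx, rfl⟩
      let e := ContinuousLinearMap.toContinuousLinearEquivOfDetNeZero _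
        (hdet0 x (ball_subset_closedBall hx) t ht)
      have : HasStrictFDerivAt (s t) (e : E →L[ℝ] E) x := hsd t x
      rw [← this.map_nhds_eq_of_equiv]
      exact Filter.image_mem_map (isOpen_ball.mem_nhds hx)
    have hclosed : IsClosed (s t '' closedBall 0 R) :=
      ((isCompact_closedBall _ _).image hsc).isClosed
    refine hsub.antisymm (IsPreconnected.subset_left_of_subset_union hopen hclosed.isOpen_compl
      ?_ ?_ ?_ (convex_ball (0 : E) R).isPreconnected)
    · exact disjoint_compl_right.mono_left (image_mono ball_subset_closedBall)
    · intro y hy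
      by_cases h : y ∈ s t '' closedBall 0 R
      · obtain ⟨x, hx, rfl⟩ := h
        left
        refine ⟨x, ?_, rfl⟩
        rw [mem_ball_zero_iff]
        refine lt_of_le_of_ne (mem_closedBall_zero_iff.1 hx) fun hxR => ?_
        have : s t x = x := by simp [hs, hfix x hxR]
        rw [this, mem_ball_zero_iff] at hy
        exact hy.ne hxR
      · exact Or.inr h
    · exact ⟨s t 0, hsub ⟨0, by simpa, rfl⟩, 0, by simpa, rfl⟩
  set V : ℝ := (volume : Measure E).real (ball 0 R)
  have hV : 0 < V := ENNReal.toReal_pos (measure_ball_pos _ _ hR).ne' measure_ball_lt_top.ne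
  have hint : ∀ t ∈ Icc 0 a,
      ∫ x in ball (0 : E) R, (ContinuousLinearMap.id ℝ E + t • A x).det = V := by
    intro t ht
    have h1 := integral_image_eq_integral_abs_det_fderiv_smul (volume : Measure E)
      (measurableSet_ball (x := (0 : E)) (ε := R))
      (fun x _ => (hsd t x).hasFDerivAt.hasFDerivWithinAt)
      ((hinj t ht).mono ball_subset_closedBall) (fun _ => (1 : ℝ))
    rw [himage t ht] at h1
    simp only [integral_const, smul_eq_mul, mul_one, measureReal_restrict_apply_univ] at h1
    rw [show V = _ from h1]
    refine setIntegral_congr_fun measurableSet_ball fun x hx => ?_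
    exact (abs_of_pos (hdet x (ball_subset_closedBall hx) t ht)).symm
  obtain ⟨τ, w, hτ, hw, hpoly⟩ := exists_extrapolation (Module.finrank ℝ E) ha0
  have hzero : ∀ x, ∑ i ∈ Finset.range (Module.finrank ℝ E + 1),
      w i * (ContinuousLinearMap.id ℝ E + τ i • A x).det = 0 := by
    intro x
    obtain ⟨p, hp, hpe⟩ := exists_polynomial_eval_eq_det (A x)
    have := hpoly p hp
    simp only [hpe] at this
    rw [← this, ← det_fderiv_eq_zero_of_norm_eq hR hd hn x]
    simp [hA]
  have hfin : ∫ x in ball (0 : E) R, ∑ i ∈ Finset.range (Module.finrank ℝ E + 1),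
      w i * (ContinuousLinearMap.id ℝ E + τ i • A x).det = V := by
    rw [integral_finsetSum]
    · rw [Finset.sum_congr rfl fun i hi => by rw [integral_const_mul, hint _ (hτ i hi)],
        ← Finset.sum_mul, hw, one_mul]
    · intro i _
      have hc : Continuous fun x => w i * (ContinuousLinearMap.id ℝ E + τ i • A x).det :=
        continuous_const.mul (ContinuousLinearMap.continuous_det.comp (by fun_prop))
      exact (hc.continuousOn.integrableOn_compact (isCompact_closedBall (0 : E) R)).mono_set
        ball_subset_closedBall
  simp only [hzero, integral_zero] at hfin
  exact hV.ne hfin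

end Retraction

/-- **Brouwer fixed point theorem** for bounded continuous self-maps of a Euclidean space. -/
theorem exists_eq_of_continuous_of_norm_le {E : Type*} [NormedAddCommGroup E]
    [InnerProductSpace ℝ E] [FiniteDimensional ℝ E] {F : E → E} (hF : Continuous F) {M : ℝ}
    (hM : ∀ x, ‖F x‖ ≤ M) : ∃ x, F x = x := by
  let _ : MeasurableSpace E := borel E
  have : BorelSpace E := ⟨rfl⟩
  by_contra! hne
  have hM0 : 0 ≤ M := (norm_nonneg _).trans (hM 0)
  obtain ⟨x₀, -, hx₀⟩ := (isCompact_closedBall (0 : E) (M + 1)).exists_isMinOn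
    ⟨0, by simp; positivity⟩ (hF.dist continuous_id).continuousOn
  set δ := min 1 (dist (F x₀) x₀)
  have hδ : 0 < δ := lt_min one_pos (dist_pos.2 (hne x₀))
  obtain ⟨K, hK, hKF, -⟩ := hF.exists_contDiff_approx (ε := fun _ => δ) 1 continuous_const
    fun _ => hδ
  have hKn : ∀ x, ‖K x‖ < M + 1 := fun x => by
    have h1 : ‖K x - F x‖ < 1 := by
      rw [← dist_eq_norm]; exact (hKF x).trans_le (min_le_left _ _)
    have h2 := norm_add_le (K x - F x) (F x)
    rw [sub_add_cancel] at h2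
    linarith [hM x]
  let χ : ContDiffBump (0 : E) := ⟨M + 1, M + 2, by positivity, by linarith⟩
  let G : E → E := fun x => x - χ x • K x
  have hG : ContDiff ℝ 1 G := contDiff_id.sub (χ.contDiff.smul hK)
  have hG0 : ∀ x, G x ≠ 0 := by
    intro x hx
    by_cases hxM : x ∈ closedBall (0 : E) (M + 1)
    · have h1 : χ x = 1 := χ.one_of_mem_closedBall hxM
      simp only [G, h1, one_smul, sub_eq_zero] at hx
      have h2 := hKF x
      rw [← hx, dist_comm] at h2
      exact (h2.trans_le ((min_le_right _ _).trans (hx₀ hxM))).false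
    · rw [mem_closedBall_zero_iff, not_le] at hxM
      have h1 : x = χ x • K x := sub_eq_zero.1 hx
      have h2 : ‖χ x • K x‖ ≤ ‖K x‖ := by
        rw [norm_smul, Real.norm_of_nonneg χ.nonneg]
        exact mul_le_of_le_one_left (norm_nonneg _) χ.le_one
      rw [← h1] at h2
      linarith [hKn x]
  refine not_exists_contDiff_retraction (R := M + 2) (by positivity)
    (r := fun x => ((M + 2) * ‖G x‖⁻¹) • G x) ?_ ?_ ?_
  · exact (contDiff_const.mul ((hG.norm ℝ hG0).inv fun x => norm_ne_zero_iff.2 (hG0 x))).smul hG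
  · intro x
    have := norm_ne_zero_iff.2 (hG0 x)
    rw [norm_smul, norm_mul, norm_inv, norm_norm, Real.norm_of_nonneg (by positivity)]
    field_simp
  · intro x hx
    have h1 : χ x = 0 := χ.zero_of_le_dist (by simp [hx, χ])
    have h2 : G x = x := by simp [G, h1]
    have h3 : M + 2 ≠ 0 := by positivity
    simp only [h2, hx, mul_inv_cancel₀ h3, one_smul]

/-- The unit cube in `c`-dimensional Euclidean space. -/
abbrev UnitCube (c : ℕ) : Type :=
  {x : EuclideanSpace ℝ (Fin c) // ∀ i, x i ∈ Icc (0 : ℝ) 1}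

theorem isCompact_setOf_forall_mem_Icc (c : ℕ) :
    IsCompact {x : EuclideanSpace ℝ (Fin c) | ∀ i, x i ∈ Icc (0 : ℝ) 1} := by
  have h := (PiLp.homeomorph 2 fun _ : Fin c => ℝ).isCompact_preimage.2
    (isCompact_univ_pi fun _ : Fin c => isCompact_Icc (a := (0 : ℝ)) (b := 1))
  convert h using 1
  ext x
  exact ⟨fun h i _ => h i, fun h i => h i trivial⟩

instance (c : ℕ) : CompactSpace (UnitCube c) :=
  isCompact_iff_compactSpace.1 (isCompact_setOf_forall_mem_Icc c)

/-- Coordinatewise projection onto the unit cube. -/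
noncomputable def projCube (c : ℕ) (x : EuclideanSpace ℝ (Fin c)) : UnitCube c :=
  ⟨WithLp.toLp 2 fun i => (projIcc (0 : ℝ) 1 zero_le_one (x i) : ℝ),
    fun i => (projIcc (0 : ℝ) 1 zero_le_one (x i)).2⟩

theorem continuous_projCube (c : ℕ) : Continuous (projCube c) := by
  unfold projCube
  refine Continuous.subtype_mk ((PiLp.continuous_toLp 2 _).comp (continuous_pi fun i => ?_)) _
  exact continuous_subtype_val.comp (continuous_projIcc.comp (by fun_prop))

/-- **Poincaré–Miranda theorem.** -/
theorem UnitCube.exists_eq_zero {c : ℕ} {H : UnitCube c → EuclideanSpace ℝ (Fin c)}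
    (hH : Continuous H) (h0 : ∀ x i, x.1 i = 0 → H x i < 0) (h1 : ∀ x i, x.1 i = 1 → 0 < H x i) :
    ∃ x, H x = 0 := by
  obtain ⟨M, hM⟩ := (isCompact_setOf_forall_mem_Icc c).isBounded.exists_norm_le
  have hP := continuous_projCube c
  obtain ⟨x, hx⟩ := exists_eq_of_continuous_of_norm_le
    (F := fun x => (projCube c ((projCube c x).1 - H (projCube c x))).1) (by fun_prop)
    fun x => hM _ (projCube c _).2
  obtain ⟨p, hp⟩ : ∃ p : UnitCube c, p.1 = x := ⟨_, hx⟩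
  have hpx : projCube c x = p := by
    ext i
    simpa [projCube, hp] using congrArg Subtype.val (projIcc_of_mem zero_le_one (p.2 i))
  refine ⟨p, ?_⟩
  ext i
  have hi : max 0 (min 1 (p.1 i - H p i)) = p.1 i := by
    simp only [hpx] at hx
    rw [← hp] at hx
    exact congrArg (fun z : EuclideanSpace ℝ (Fin c) => z i) hx
  have hl := (p.2 i).1
  have hu := (p.2 i).2
  simp only [PiLp.zero_apply]
  rcases hl.eq_or_lt with h | h
  · have := h0 p i h.symm
    rw [← h, max_eq_left_iff] at hi
    rcases min_le_iff.1 hi with h' | h' <;> linarith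
  · rcases hu.eq_or_lt with h' | h'
    · have := h1 p i h'
      rw [h', max_eq_iff] at hi
      rcases hi with hi | hi
      · linarith [hi.1]
      · linarith [min_eq_left_iff.1 hi.1]
    · rcases max_eq_iff.1 hi with hi | hi
      · linarith [hi.1]
      · rcases min_eq_iff.1 hi.1 with hi | hi <;> linarith [hi.1]

/-- Disjoint closed sets not joined by a component of the closed set `S` can be separated by a
continuous function taking only the values `0` and `1` near `S`. -/
theorem exists_continuous_zero_one_near {X : Type*} [TopologicalSpace X] [CompactSpace X]
    [T2Space X] {S A B : Set X} (hS : IsClosed S) (hA : IsClosed A) (hB : IsClosed B)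
    (hAB : Disjoint A B)
    (h : ∀ x ∈ S ∩ A, Disjoint (connectedComponentIn S x) B) :
    ∃ u : C(X, ℝ), EqOn u 0 A ∧ EqOn u 1 B ∧ ∃ W, IsOpen W ∧ S ⊆ W ∧
      ∀ x ∈ W, u x = 0 ∨ u x = 1 := by
  have : CompactSpace S := isCompact_iff_compactSpace.1 hS.isCompact
  let π : S → ConnectedComponents S := (↑)
  have hπ : Continuous π := ConnectedComponents.continuous_coe
  have hA' : IsClosed (π '' (Subtype.val ⁻¹' A)) :=
    ((hA.preimage continuous_subtype_val).isCompact.image hπ).isClosed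
  have hB' : IsClosed (π '' (Subtype.val ⁻¹' B)) :=
    ((hB.preimage continuous_subtype_val).isCompact.image hπ).isClosed
  have hdisj : π '' (Subtype.val ⁻¹' A) ⊆ (π '' (Subtype.val ⁻¹' B))ᶜ := by
    rintro _ ⟨a, ha, rfl⟩ ⟨b, hb, hab⟩
    refine Set.disjoint_left.1 (h a ⟨a.2, ha⟩) ?_ hb
    rw [connectedComponentIn_eq_image a.2]
    exact ⟨b, ConnectedComponents.coe_eq_coe'.1 hab, rfl⟩
  obtain ⟨D, hD, hAD, hDB⟩ := exists_clopen_of_closed_subset_open hA' hB'.isOpen_compl hdisj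
  have hDc : IsClopen (π ⁻¹' D) := hD.preimage hπ
  set C₀ : Set X := Subtype.val '' (π ⁻¹' D)
  set C₁ : Set X := Subtype.val '' (π ⁻¹' D)ᶜ
  have hC₀ : IsClosed C₀ := hS.isClosedEmbedding_subtypeVal.isClosedMap _ hDc.isClosed
  have hC₁ : IsClosed C₁ := hS.isClosedEmbedding_subtypeVal.isClosedMap _ hDc.compl.isClosed
  obtain ⟨w, hw0, hw1, hw⟩ := exists_continuous_zero_one_of_isClosed (hC₀.union hA) (hC₁.union hB)
    (by
      rw [Set.disjoint_left]
      rintro x (⟨a, ha, rfl⟩ | ha) (⟨b, hb, hab⟩ | hb)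
      · rw [Subtype.val_injective hab] at hb
        exact hb ha
      · exact hDB ha ⟨a, hb, rfl⟩
      · subst hab
        exact hb (hAD ⟨b, ha, rfl⟩)
      · exact hAB.le_bot ⟨ha, hb⟩)
  refine ⟨⟨fun x => max 0 (min 1 (3 * w x - 1)), by fun_prop⟩, fun x hx => ?_, fun x hx => ?_,
    {x | w x < 1 / 3} ∪ {x | 2 / 3 < w x}, ?_, fun x hx => ?_, fun x hx => ?_⟩
  · have : w x = 0 := hw0 (Or.inr hx)
    simp [this]
  · have : w x = 1 := hw1 (Or.inr hx)
    norm_num [this]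
  · exact (isOpen_lt (by fun_prop) (by fun_prop)).union (isOpen_lt (by fun_prop) (by fun_prop))
  · by_cases hxD : (⟨x, hx⟩ : S) ∈ π ⁻¹' D
    · have : w x = 0 := hw0 (Or.inl ⟨_, hxD, rfl⟩)
      left; simp [this]
    · have : w x = 1 := hw1 (Or.inl ⟨_, hxD, rfl⟩)
      right; norm_num [this]
  · rcases hx with hx | hx
    · left
      have hx : w x < 1 / 3 := hx
      exact max_eq_left ((min_le_right _ _).trans (by linarith))
    · right
      have hx : 2 / 3 < w x := hx
      simp only [ContinuousMap.coe_mk]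
      rw [min_eq_left (by linarith), max_eq_right zero_le_one]

theorem IsLightMap.exists_continuous_zero_one {c : ℕ} {Y : Type*} [MetricSpace Y]
    {f : UnitCube c → Y} (hf : Continuous f) (hl : IsLightMap f 1) (y : Y) (j : Fin c) :
    ∃ u : C(UnitCube c, ℝ), (∀ x, x.1 j = 0 → u x = 0) ∧ (∀ x, x.1 j = 1 → u x = 1) ∧
      ∃ r > 0, ∀ x, dist (f x) y < r → u x = 0 ∨ u x = 1 := by
  have hc : Continuous fun x : UnitCube c => x.1 j := by fun_prop
  obtain ⟨u, hu0, hu1, W, hW, hSW, huW⟩ := exists_continuous_zero_one_near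
    (S := f ⁻¹' {y}) (A := {x | x.1 j = 0}) (B := {x | x.1 j = 1})
    (isClosed_singleton.preimage hf) (isClosed_eq hc continuous_const)
    (isClosed_eq hc continuous_const)
    (Set.disjoint_left.2 fun x (h0 : x.1 j = 0) (h1 : x.1 j = 1) => by simp [h0] at h1)
    (by
      rintro x ⟨hxS, hxA : x.1 j = 0⟩
      refine Set.disjoint_left.2 fun z hz (hzB : z.1 j = 1) => ?_
      have h1 : edist x z < ENNReal.ofReal 1 :=
        (Metric.edist_le_ediam_of_mem (mem_connectedComponentIn hxS) hz).trans_lt (hl y x hxS)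
      rw [edist_dist, ENNReal.ofReal_lt_ofReal_iff one_pos] at h1
      have h2 : ‖(x.1 - z.1) j‖ ≤ ‖x.1 - z.1‖ := PiLp.norm_apply_le _ j
      rw [← dist_eq_norm, PiLp.sub_apply, hxA, hzB] at h2
      norm_num at h2
      exact (h2.trans_lt h1).false)
  refine ⟨u, fun x hx => hu0 hx, fun x hx => hu1 hx, ?_⟩
  have hcl : IsClosed (f '' Wᶜ) := (hW.isClosed_compl.isCompact.image hf).isClosed
  obtain ⟨r, hr, hball⟩ := Metric.isOpen_iff.1 hcl.isOpen_compl y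
    (by rintro ⟨x, hx, hxy⟩; exact hx (hSW hxy))
  refine ⟨r, hr, fun x hx => huW x ?_⟩
  by_contra hxW
  exact hball (mem_ball.2 hx) ⟨x, hxW, rfl⟩

/-- Finitely many unstable values can be avoided simultaneously by a small perturbation. -/
theorem exists_continuous_near_forall_ne {X E : Type*} [MetricSpace X]
    [NormedAddCommGroup E] [NormedSpace ℝ E] {f : X → E} (hf : Continuous f) (T : Finset E)
    (hT : ∀ y ∈ T, ¬ IsStableValue f y) {η : ℝ} (hη : 0 < η) :
    ∃ g : X → E, Continuous g ∧ (∀ x, dist (f x) (g x) < η) ∧ ∀ y ∈ T, ∀ x, g x ≠ y := by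
  obtain ⟨ρ, hρ, hsep⟩ : ∃ ρ > (0 : ℝ), ∀ a ∈ T, ∀ b ∈ T, a ≠ b → 4 * ρ ≤ dist a b := by
    have : ∀ᶠ ρ in nhdsWithin (0 : ℝ) (Ioi 0), ∀ a ∈ T, ∀ b ∈ T, a ≠ b → 4 * ρ ≤ dist a b := by
      simp only [Filter.eventually_all_finset]
      intro a _ b _
      by_cases hab : a = b
      · simp [hab]
      · filter_upwards [Ioo_mem_nhdsGT (show 0 < dist a b / 4 by
          have := dist_pos.2 hab; positivity)] with ρ hρ _
        linarith [hρ.2]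
    obtain ⟨ρ, h, hρ⟩ := (this.and self_mem_nhdsWithin).exists
    exact ⟨ρ, hρ, h⟩
  have hg : ∀ y : T, ∃ g : X → E, Continuous g ∧ (∀ x, dist (f x) (g x) < min η ρ) ∧
      ∀ x, g x ≠ y := by
    intro y
    have := hT y y.2
    simp only [IsStableValue, not_exists, not_and, not_forall, mem_range] at this
    obtain ⟨g, h1, h2, h3⟩ := this (min η ρ) (lt_min hη hρ)
    exact ⟨g, h1, h2, h3⟩
  choose g hgc hgd hgn using hg
  let l : E → E → ℝ := fun y z => max 0 (min 1 (2 - dist z y / ρ))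
  have hl1 : ∀ y z, dist z y < ρ → l y z = 1 := by
    intro y z h
    have : dist z y / ρ < 1 := (div_lt_one hρ).2 h
    simp only [l]
    rw [min_eq_left (by linarith), max_eq_right zero_le_one]
  have hl0 : ∀ y z, 2 * ρ ≤ dist z y → l y z = 0 := by
    intro y z h
    have : 2 ≤ dist z y / ρ := (le_div_iff₀ hρ).2 h
    exact max_eq_left ((min_le_right _ _).trans (by linarith))
  have hl : ∀ y z, 0 ≤ l y z ∧ l y z ≤ 1 := fun y z =>
    ⟨le_max_left _ _, max_le zero_le_one (min_le_left _ _)⟩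
  let G : X → E := fun x => f x + ∑ y : T, l y (f x) • (g y x - f x)
  have hG : ∀ x (y : T), dist (f x) y < 2 * ρ → G x = f x + l y (f x) • (g y x - f x) := by
    intro x y hy
    simp only [G]
    rw [Finset.sum_eq_single y _ (by simp)]
    intro b _ hb
    rw [hl0, zero_smul]
    have h1 := hsep b b.2 y y.2 (fun h => hb (Subtype.ext h))
    have h2 := dist_triangle_left (b : E) y (f x)
    linarith
  have hGd : ∀ x, dist (f x) (G x) < min η ρ := by
    intro x
    by_cases h : ∃ y : T, dist (f x) y < 2 * ρ
    · obtain ⟨y, hy⟩ := h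
      rw [hG x y hy, dist_self_add_right, norm_smul, Real.norm_of_nonneg (hl _ _).1]
      refine (mul_le_of_le_one_left (norm_nonneg _) (hl _ _).2).trans_lt ?_
      rw [← dist_eq_norm, dist_comm]
      exact hgd y x
    · push Not at h
      have : G x = f x := by
        simp only [G, add_eq_left]
        exact Finset.sum_eq_zero fun y _ => by rw [hl0 _ _ (h y), zero_smul]
      rw [this, dist_self]
      exact lt_min hη hρ
  refine ⟨G, ?_, fun x => (hGd x).trans_le (min_le_left _ _), fun y hy x hxy => ?_⟩
  · fun_prop
  · have h1 : dist (f x) y < ρ := by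
      rw [← hxy]
      exact (hGd x).trans_le (min_le_right _ _)
    rw [hG x ⟨y, hy⟩ (by dsimp only; linarith), hl1 _ _ h1, one_smul, add_sub_cancel] at hxy
    exact hgn ⟨y, hy⟩ x hxy

/-- Given finitely many `C¹` maps, a generic point has finite preimages in a compact set. -/
theorem exists_forall_finite_fiber {E ι : Type*} [NormedAddCommGroup E] [NormedSpace ℝ E]
    [FiniteDimensional ℝ E] [Countable ι] {A : ι → E → E} {Ω K U : Set E} (hΩ : IsOpen Ω)
    (hA : ∀ s, DifferentiableOn ℝ (A s) Ω) (hK : IsCompact K) (hKΩ : K ⊆ Ω)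
    (hU : IsOpen U) (hUne : U.Nonempty) :
    ∃ q ∈ U, ∀ s, {z ∈ K | A s z = q}.Finite := by
  let _ : MeasurableSpace E := borel E
  have : BorelSpace E := ⟨rfl⟩
  let μ : Measure E := Measure.addHaar
  have hd : ∀ s, ∀ z ∈ Ω, HasFDerivAt (A s) (fderiv ℝ (A s) z) z := fun s z hz =>
    ((hA s z hz).differentiableAt (hΩ.mem_nhds hz)).hasFDerivAt
  have hnull : μ (⋃ s, A s '' {z ∈ Ω | (fderiv ℝ (A s) z).det = 0}) = 0 :=
    measure_iUnion_null fun s => addHaar_image_eq_zero_of_det_fderivWithin_eq_zero μ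
      (fun z hz => (hd s z hz.1).hasFDerivWithinAt) fun z hz => hz.2
  obtain ⟨q, hqU, hq⟩ : ∃ q ∈ U, q ∉ ⋃ s, A s '' {z ∈ Ω | (fderiv ℝ (A s) z).det = 0} := by
    by_contra! h
    exact (hU.measure_pos μ hUne).ne' (measure_mono_null h hnull)
  refine ⟨q, hqU, fun s => Set.not_infinite.1 fun hinf => ?_⟩
  obtain ⟨z, hzK, hz⟩ := hinf.exists_accPt_of_subset_isCompact hK (sep_subset _ _)
  rw [accPt_iff_frequently_nhdsNE] at hz
  refine hz ?_
  suffices ∀ᶠ w in nhdsWithin z {z}ᶜ, A s w ≠ q from this.mono fun w hw h => hw h.2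
  by_cases hzq : A s z = q
  · have hdet : (fderiv ℝ (A s) z).det ≠ 0 := fun h0 =>
      hq (mem_iUnion.2 ⟨s, z, ⟨hKΩ hzK, h0⟩, hzq⟩)
    let e := ContinuousLinearMap.toContinuousLinearEquivOfDetNeZero _ hdet
    exact (hd s z (hKΩ hzK)).eventually_ne ⟨_, e.antilipschitz⟩
  · exact ((hd s z (hKΩ hzK)).continuousAt.eventually_ne hzq).filter_mono nhdsWithin_le_nhds

theorem IsLightMap.exists_isStableValue {c : ℕ} {f : UnitCube c → EuclideanSpace ℝ (Fin c)}
    (hf : Continuous f) (hl : IsLightMap f 1) : ∃ y, IsStableValue f y := by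
  classical
  by_contra! hns
  choose u hu0 hu1 r₀ hr₀ hur₀ using hl.exists_continuous_zero_one hf
  have hr : ∀ y, ∃ r > 0, ∀ j x, dist (f x) y < r → u y j x = 0 ∨ u y j x = 1 := by
    intro y
    have : ∀ᶠ r in nhdsWithin (0 : ℝ) (Ioi 0), ∀ j, r < r₀ y j :=
      Filter.eventually_all.2 fun j =>
        Filter.mem_of_superset (Ioo_mem_nhdsGT (hr₀ y j)) fun r hr => hr.2
    obtain ⟨r, h, hr⟩ := (this.and self_mem_nhdsWithin).exists
    exact ⟨r, hr, fun j x hx => hur₀ y j x (hx.trans (h j))⟩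
  choose r hr hur using hr
  let φ : ∀ y : EuclideanSpace ℝ (Fin c), ContDiffBump y := fun y =>
    ⟨r y / 4, r y / 2, by have := hr y; positivity, by linarith [hr y]⟩
  obtain ⟨T, hT⟩ := (isCompact_range hf).elim_finite_subcover (fun y => ball y (r y / 4))
    (fun _ => isOpen_ball) fun y _ => mem_iUnion.2 ⟨y, mem_ball_self (by linarith [hr y])⟩
  let Φ : EuclideanSpace ℝ (Fin c) → ℝ := fun z => ∑ v : T, φ v z
  have hΦd : ContDiff ℝ 1 Φ := ContDiff.sum fun v _ => (φ v).contDiff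
  let Ω := {z | 0 < Φ z}
  have hΩ : IsOpen Ω := isOpen_lt continuous_const hΦd.continuous
  have hfΩ : range f ⊆ Ω := by
    intro z hz
    obtain ⟨v, hv, hzv⟩ := mem_iUnion₂.1 (hT hz)
    have hpos : 0 < φ v z :=
      (φ v).pos_of_mem_ball (ball_subset_ball (by simp only [φ]; linarith [hr v]) hzv)
    exact hpos.trans_le (Finset.single_le_sum (f := fun w : T => φ w z)
      (fun w _ => (φ w).nonneg) (Finset.mem_univ ⟨v, hv⟩))
  obtain ⟨δ₁, hδ₁, hδΩ⟩ := (isCompact_range hf).exists_cthickening_subset_open hΩ hfΩ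
  obtain ⟨δ₂, hδ₂, hδT⟩ : ∃ δ > 0, ∀ v ∈ T, δ < r v / 2 := by
    have : ∀ᶠ δ in nhdsWithin (0 : ℝ) (Ioi 0), ∀ v ∈ T, δ < r v / 2 := by
      rw [Filter.eventually_all_finset]
      exact fun v _ => Filter.mem_of_superset (Ioo_mem_nhdsGT (half_pos (hr v))) fun r hr => hr.2
    obtain ⟨δ, h, hδ⟩ := (this.and self_mem_nhdsWithin).exists
    exact ⟨δ, hδ, h⟩
  let σ : (T → Fin c → Bool) → T → EuclideanSpace ℝ (Fin c) := fun s v =>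
    WithLp.toLp 2 fun j => if s v j then 1 else 0
  let A : (T → Fin c → Bool) → EuclideanSpace ℝ (Fin c) → EuclideanSpace ℝ (Fin c) :=
    fun s z => (Φ z)⁻¹ • ∑ v : T, φ v z • σ s v
  have hA : ∀ s, DifferentiableOn ℝ (A s) Ω := by
    intro s
    refine ((hΦd.differentiable (by simp)).differentiableOn.inv fun z hz => ne_of_gt hz).smul ?_
    refine (Differentiable.fun_sum fun v _ => ?_).differentiableOn
    exact ((φ v).contDiff.differentiable (n := 1) (by simp)).smul_const _
  have hK : IsCompact (cthickening δ₁ (range f)) := (isCompact_range hf).cthickening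
  obtain ⟨q, hq, hfin⟩ := exists_forall_finite_fiber hΩ hA hK hδΩ
    (U := {q | ∀ j, q j ∈ Ioo (0 : ℝ) 1})
    (by
      simp only [ofPred_forall]
      exact isOpen_iInter_of_finite fun j => isOpen_Ioo.preimage (by fun_prop))
    ⟨WithLp.toLp 2 fun _ => 1 / 2, fun j => by norm_num⟩
  have hfinU := Set.finite_iUnion hfin
  obtain ⟨g, hg, hfg, hgne⟩ := exists_continuous_near_forall_ne hf hfinU.toFinset
    (fun y _ => hns y) (lt_min hδ₁ hδ₂)
  have hgK : ∀ x, g x ∈ cthickening δ₁ (range f) := fun x =>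
    mem_cthickening_of_dist_le _ _ _ _ (mem_range_self x)
      (by rw [dist_comm]; exact (hfg x).le.trans (min_le_left _ _))
  have hΦg : ∀ x, 0 < Φ (g x) := fun x => hδΩ (hgK x)
  let H : UnitCube c → EuclideanSpace ℝ (Fin c) := fun x =>
    ∑ v : T, φ v (g x) • ((WithLp.toLp 2 fun j => u v j x) - q)
  have hHj : ∀ x j, H x j = ∑ v : T, φ v (g x) * (u v j x - q j) := by
    intro x j
    simp [H]
  have hHc : Continuous H := by
    refine continuous_finsetSum _ fun v _ => ((φ v).continuous.comp hg).smul ?_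
    exact ((PiLp.continuous_toLp 2 _).comp
      (continuous_pi fun j => (u v j).continuous)).sub continuous_const
  obtain ⟨x, hx⟩ := UnitCube.exists_eq_zero hHc
    (fun x j hx => by
      rw [hHj, Finset.sum_congr rfl fun v _ => by rw [hu0 v j x hx], ← Finset.sum_mul]
      exact mul_neg_of_pos_of_neg (hΦg x) (by linarith [(hq j).1]))
    (fun x j hx => by
      rw [hHj, Finset.sum_congr rfl fun v _ => by rw [hu1 v j x hx], ← Finset.sum_mul]
      exact mul_pos (hΦg x) (by linarith [(hq j).2]))
  let s : T → Fin c → Bool := fun v j => decide (u v j x = 1)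
  refine hgne (g x) (hfinU.mem_toFinset.2 (mem_iUnion.2 ⟨s, hgK x, ?_⟩)) x rfl
  have hterm : ∀ v : T,
      φ v (g x) • ((WithLp.toLp 2 fun j => u v j x) - q) = φ v (g x) • (σ s v - q) := by
    intro v
    rcases le_or_gt (r v / 2) (dist (g x) v) with h | h
    · rw [(φ v).zero_of_le_dist h, zero_smul, zero_smul]
    · congr 2
      ext j
      have hd : dist (f x) v < r v := by
        have := dist_triangle (f x) (g x) v
        linarith [hδT v v.2, (hfg x).trans_le (min_le_right _ _)]
      rcases hur v j x hd with h | h <;> simp [σ, s, h]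
  have hsum : ∑ v : T, φ v (g x) • σ s v = Φ (g x) • q := by
    have : ∑ v : T, φ v (g x) • (σ s v - q) = 0 := by
      rw [← hx]
      exact Finset.sum_congr rfl fun v _ => (hterm v).symm
    simp only [smul_sub, Finset.sum_sub_distrib, ← Finset.sum_smul] at this
    exact sub_eq_zero.1 this
  simp only [A, hsum]
  exact inv_smul_smul₀ (hΦg x).ne' q

/-- For every positive integer `c` there is `ε = ε(c) > 0` such that every continuous
`ε`-light map `f : [0,1]^c → ℝ^c` has a stable value. -/
theorem stmt0 (c : ℕ) (hc : 0 < c) :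
    ∃ ε > (0 : ℝ),
      ∀ f : {x : EuclideanSpace ℝ (Fin c) // ∀ i, x i ∈ Set.Icc (0 : ℝ) 1} →
          EuclideanSpace ℝ (Fin c),
        Continuous f → IsLightMap f ε → ∃ y, IsStableValue f y := by
  exact ⟨1, one_pos, fun f hf hl => IsLightMap.exists_isStableValue hf hl⟩
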